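/- arXiv:2410.20187 — 2 statements merged into one kernel-verified Lean document; each statement's English description precedes it below -/
import Mathlib

section
/- Let E be a real normed vector space, let f, g : E → ℝ be functions differentiable at θ ∈ E with f θ > 0 and g θ > 0, let c_w, c_l > 0, β ∈ ℝ and Δ ∈ ℝ. Define the margin-penalized DPO loss L : E → ℝ by L(θ') = −log (σ (β * log (f θ' / c_w) − β * log (g θ' / c_l) + Δ)), where σ(x) = 1 / (1 + exp(−x)), and set ρ = β * log (f θ / c_w) − β * log (g θ / c_l). Then L is differentiable at θ and fderiv L θ = −β * σ(−ρ − Δ) • ((1 / f θ) • fderiv f θ − (1 / g θ) • fderiv g θ). In particular the gradient-magnitude coefficient σ(−ρ − Δ) is strictly decreasing in the margin Δ, so a higher positive margin attenuates the gradient update. -/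
noncomputable def sigma (x : ℝ) : ℝ := 1 / (1 + Real.exp (-x))

lemma sigma_eq_sigmoid : sigma = Real.sigmoid :=
  funext fun x => by rw [sigma, Real.sigmoid_def, one_div]

/-- The derivative of the logistic loss `-log ∘ σ` at `x` is `-σ(-x)`. -/
lemma hasDerivAt_neg_log_sigma (x : ℝ) :
    HasDerivAt (fun y => -Real.log (sigma y)) (-sigma (-x)) x := by
  rw [sigma_eq_sigmoid]
  have hx := (Real.sigmoid_pos x).ne'
  refine ((Real.hasDerivAt_sigmoid x).log hx).neg.congr_deriv ?_
  rw [Real.sigmoid_neg, mul_div_cancel_left₀ _ hx]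

/-- Dividing by a nonzero constant does not change the derivative of the logarithm. -/
lemma HasFDerivAt.log_div_const {E : Type*} [NormedAddCommGroup E] [NormedSpace ℝ E]
    {f : E → ℝ} {f' : E →L[ℝ] ℝ} {x : E} (hf : HasFDerivAt f f' x) (hx : f x ≠ 0)
    {c : ℝ} (hc : c ≠ 0) :
    HasFDerivAt (fun y => Real.log (f y / c)) ((1 / f x) • f') x := by
  have h := (hf.mul_const c⁻¹).log (mul_ne_zero hx (inv_ne_zero hc))
  simp only [← div_eq_mul_inv] at h
  refine h.congr_fderiv ?_
  rw [smul_smul]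
  congr 1
  field_simp

/-- The margin-penalized DPO loss gradient formula: the loss
`L θ' = −log σ(β log (f θ'/c_w) − β log (g θ'/c_l) + Δ)` is differentiable at `θ` with
derivative `−β σ(−ρ−Δ) • ((1/f θ) • fderiv f θ − (1/g θ) • fderiv g θ)`; moreover the
gradient-magnitude coefficient `σ(−ρ−Δ')` is strictly decreasing in the margin `Δ'`. -/
theorem penalized_dpo_loss_gradient {E : Type*} [NormedAddCommGroup E] [NormedSpace ℝ E]
    (f g : E → ℝ) (θ : E)
    (hf : DifferentiableAt ℝ f θ) (hg : DifferentiableAt ℝ g θ)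
    (hfθ : 0 < f θ) (hgθ : 0 < g θ)
    (cw cl : ℝ) (hcw : 0 < cw) (hcl : 0 < cl) (β Δ : ℝ)
    (L : E → ℝ)
    (hL : ∀ θ', L θ' =
      -Real.log (sigma (β * Real.log (f θ' / cw) - β * Real.log (g θ' / cl) + Δ)))
    (ρ : ℝ) (hρ : ρ = β * Real.log (f θ / cw) - β * Real.log (g θ / cl)) :
    HasFDerivAt L
      ((-(β * sigma (-ρ - Δ))) •
        ((1 / f θ) • fderiv ℝ f θ - (1 / g θ) • fderiv ℝ g θ)) θ ∧
    StrictAnti (fun Δ' : ℝ => sigma (-ρ - Δ')) := by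
  refine ⟨?_, fun a b hab => ?_⟩
  · have hmargin := (((hf.hasFDerivAt.log_div_const hfθ.ne' hcw.ne').const_mul β).sub
      ((hg.hasFDerivAt.log_div_const hgθ.ne' hcl.ne').const_mul β)).add_const Δ
    rw [funext hL]
    refine ((hasDerivAt_neg_log_sigma _).comp_hasFDerivAt θ hmargin).congr_fderiv ?_
    simp only [Pi.sub_apply, ← hρ]
    rw [← smul_sub, smul_smul, neg_add', neg_mul, mul_comm β]
  · simp only [sigma_eq_sigmoid]
    exact Real.sigmoid_strictMono (sub_lt_sub_left hab _)
end

section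
/- Let Y be a nonempty finite type, let π_ref : Y → ℝ be a probability mass function with π_ref y > 0 for all y, let r : Y → ℝ, u : Y → ℝ, β > 0 and τ > 0. Define the energy-factor penalized reward r̃ y = r y * exp(−u y / τ), the partition function Z_u = ∑_y π_ref y * exp(r̃ y / β), and the policy π*_u y = π_ref y * exp(r̃ y / β) / Z_u. Then π*_u is the unique maximizer over probability mass functions π of ∑_y π y * r̃ y − β * KL(π‖π_ref), and the original reward can be recovered from this policy by the inversion formula r y = exp(u y / τ) * (β * log (π*_u y / π_ref y) + β * log Z_u) for all y. -/
theorem sub_lt_mul_log_div {a b : ℝ} (ha : 0 ≤ a) (hb : 0 < b) (hab : a ≠ b) :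
    a - b < a * Real.log (a / b) := by
  rcases ha.eq_or_lt with rfl | ha
  · simpa using hb
  · have hne : b / a ≠ 1 := fun h => hab ((div_eq_one_iff_eq ha.ne').1 h).symm
    have h := mul_lt_mul_of_pos_left (Real.log_lt_sub_one_of_pos (div_pos hb ha) hne) ha
    rw [mul_sub, mul_div_cancel₀ _ ha.ne', ← inv_div a b, Real.log_inv] at h
    linarith

theorem sub_le_mul_log_div {a b : ℝ} (ha : 0 ≤ a) (hb : 0 < b) :
    a - b ≤ a * Real.log (a / b) := by
  rcases eq_or_ne a b with rfl | hab
  · simp [hb.ne']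
  · exact (sub_lt_mul_log_div ha hb hab).le

/-- Gibbs' inequality on a finite type. -/
theorem sum_mul_log_div_nonneg {Y : Type*} [Fintype Y] {p q : Y → ℝ}
    (hp : ∀ y, 0 ≤ p y) (hq : ∀ y, 0 < q y) (hsum : ∑ y, p y = ∑ y, q y) :
    0 ≤ ∑ y, p y * Real.log (p y / q y) := by
  have h := Finset.sum_le_sum fun y (_ : y ∈ Finset.univ) => sub_le_mul_log_div (hp y) (hq y)
  rwa [Finset.sum_sub_distrib, hsum, sub_self] at h

/-- The equality case of Gibbs' inequality. -/
theorem eq_of_sum_mul_log_div_eq_zero {Y : Type*} [Fintype Y] {p q : Y → ℝ}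
    (hp : ∀ y, 0 ≤ p y) (hq : ∀ y, 0 < q y) (hsum : ∑ y, p y = ∑ y, q y)
    (h : ∑ y, p y * Real.log (p y / q y) = 0) : p = q := by
  by_contra hne
  obtain ⟨y, hy⟩ := Function.ne_iff.1 hne
  have hlt := Finset.sum_lt_sum
    (fun z (_ : z ∈ Finset.univ) => sub_le_mul_log_div (hp z) (hq z))
    ⟨y, Finset.mem_univ y, sub_lt_mul_log_div (hp y) (hq y) hy⟩
  rw [Finset.sum_sub_distrib, hsum, sub_self, h] at hlt
  exact hlt.false

/-- The KL-regularized objective equals a constant minus the divergence from the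
policy `q` whose log-ratio to the reference is the reward, up to that constant. -/
theorem regularized_objective_eq {Y : Type*} [Fintype Y] {p q ref f : Y → ℝ} {β c : ℝ}
    (hq : ∀ y, 0 < q y) (href : ∀ y, 0 < ref y)
    (hf : ∀ y, f y = β * Real.log (q y / ref y) + c) (hsum : ∑ y, p y = 1) :
    (∑ y, p y * f y) - β * ∑ y, p y * Real.log (p y / ref y) =
      c - β * ∑ y, p y * Real.log (p y / q y) := by
  have hc : c = ∑ y, p y * c := by rw [← Finset.sum_mul, hsum, one_mul]
  rw [hc, Finset.mul_sum, Finset.mul_sum, ← Finset.sum_sub_distrib, ← Finset.sum_sub_distrib]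
  refine Finset.sum_congr rfl fun y _ => ?_
  rcases eq_or_ne (p y) 0 with h0 | h0
  · simp [h0]
  · rw [hf, Real.log_div h0 (href y).ne', Real.log_div h0 (hq y).ne',
      Real.log_div (hq y).ne' (href y).ne']
    ring

/-- The energy-factor penalized Gibbs policy is the unique maximizer of the
KL-regularized objective for the penalized reward `r̃ y = r y * exp (−u y / τ)`, and
the original reward is recovered by the inversion formula
`r y = exp (u y / τ) * (β log (πstaru y / πref y) + β log Z_u)`. -/
theorem energy_factor_unique_maximizer_and_inversion {Y : Type*} [Fintype Y] [Nonempty Y]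
    (πref : Y → ℝ) (href_pos : ∀ y, 0 < πref y) (href_sum : ∑ y, πref y = 1)
    (r u : Y → ℝ) (β τ : ℝ) (hβ : 0 < β) (hτ : 0 < τ)
    (rtilde : Y → ℝ) (hrtilde : ∀ y, rtilde y = r y * Real.exp (-u y / τ))
    (Zu : ℝ) (hZu : Zu = ∑ y, πref y * Real.exp (rtilde y / β))
    (πstaru : Y → ℝ)
    (hπstaru : ∀ y, πstaru y = πref y * Real.exp (rtilde y / β) / Zu) :
    ((∀ y, 0 ≤ πstaru y) ∧ (∑ y, πstaru y = 1) ∧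
      ∀ p : Y → ℝ, (∀ y, 0 ≤ p y) → (∑ y, p y = 1) →
        ((∑ y, p y * rtilde y) - β * ∑ y, p y * Real.log (p y / πref y) ≤
          (∑ y, πstaru y * rtilde y) -
            β * ∑ y, πstaru y * Real.log (πstaru y / πref y)) ∧
        (((∑ y, p y * rtilde y) - β * ∑ y, p y * Real.log (p y / πref y) =
          (∑ y, πstaru y * rtilde y) -
            β * ∑ y, πstaru y * Real.log (πstaru y / πref y)) → p = πstaru)) ∧
    ∀ y, r y = Real.exp (u y / τ) *
      (β * Real.log (πstaru y / πref y) + β * Real.log Zu) := by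
  have hZ : 0 < Zu := by
    rw [hZu]
    exact Finset.sum_pos (fun y _ => mul_pos (href_pos y) (Real.exp_pos _))
      Finset.univ_nonempty
  have hpos : ∀ y, 0 < πstaru y := fun y => by
    rw [hπstaru]
    exact div_pos (mul_pos (href_pos y) (Real.exp_pos _)) hZ
  have hone : ∑ y, πstaru y = 1 := by
    simp_rw [hπstaru]
    rw [← Finset.sum_div, ← hZu, div_self hZ.ne']
  have hlog : ∀ y, rtilde y = β * Real.log (πstaru y / πref y) + β * Real.log Zu := fun y => by
    have h : πstaru y / πref y = Real.exp (rtilde y / β) / Zu := by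
      rw [hπstaru]
      field_simp [(href_pos y).ne']
    rw [h, Real.log_div (Real.exp_pos _).ne' hZ.ne', Real.log_exp]
    field_simp
    ring
  have hself : ∑ y, πstaru y * Real.log (πstaru y / πstaru y) = 0 :=
    Finset.sum_eq_zero fun y _ => by simp [(hpos y).ne']
  refine ⟨⟨fun y => (hpos y).le, hone, fun p hp hp1 => ?_⟩, fun y => ?_⟩
  · rw [regularized_objective_eq hpos href_pos hlog hp1,
      regularized_objective_eq hpos href_pos hlog hone, hself]
    have hsum : ∑ y, p y = ∑ y, πstaru y := hp1.trans hone.symm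
    refine ⟨?_, fun h => eq_of_sum_mul_log_div_eq_zero hp hpos hsum ?_⟩
    · have := mul_nonneg hβ.le (sum_mul_log_div_nonneg hp hpos hsum)
      linarith
    · have h0 : β * ∑ y, p y * Real.log (p y / πstaru y) = 0 := by linarith
      exact (mul_eq_zero.1 h0).resolve_left hβ.ne'
  · rw [← hlog, hrtilde, mul_left_comm, ← Real.exp_add, neg_div, add_neg_cancel,
      Real.exp_zero, mul_one]
end
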